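/- Let f be a monomially tamed function on Σ_n that admits a representation f = g/h with g, h ∈ O[x,y,y^{−1}] both monomially tamed. Then every first-order partial derivative of f, with respect to any of the variables x^k or y^k, is a polynomially tamed function on Σ_n. -/

import Mathlib

namespace TamePaper

noncomputable section

/-- The point space: `n` pairs of real coordinates `(x, y)`. -/
abbrev Pt (n : ℕ) := (Fin n → ℝ) × (Fin n → ℝ)

/-- The growth sector `Σ_n = {0 < xᵏ < 1, y¹ ≥ y² ≥ ⋯ ≥ yⁿ > 1}`. -/
def GrowthSector (n : ℕ) : Set (Pt n) :=
  {p | (∀ k, 0 < p.1 k ∧ p.1 k < 1) ∧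
       (∀ k l : Fin n, k ≤ l → p.2 l ≤ p.2 k) ∧ (∀ k, 1 < p.2 k)}

/-- `f ≺ g` on `S`: there is `C > 0` with `f < C·g` everywhere on `S`. -/
def Prec {α : Type*} (S : Set α) (f g : α → ℝ) : Prop :=
  ∃ C : ℝ, 0 < C ∧ ∀ p ∈ S, f p < C * g p

/-- `f ∼ g` on `S`: `C₁·g < f < C₂·g` on `S` for two constants of the same sign. -/
def Sim {α : Type*} (S : Set α) (f g : α → ℝ) : Prop :=
  ∃ C₁ C₂ : ℝ, 0 < C₁ * C₂ ∧ ∀ p ∈ S, C₁ * g p < f p ∧ f p < C₂ * g p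

/-- The closed unit polydisk in `ℝ^{2n}`. -/
def ClosedPolydisk (n : ℕ) : Set (Fin n → ℝ × ℝ) :=
  {q | ∀ k, (q k).1 ^ 2 + (q k).2 ^ 2 ≤ 1}

/-- A restricted analytic function: real-analytic on an open neighborhood of the
closed unit polydisk. -/
def RestrictedAnalytic (n : ℕ) (ρ : (Fin n → ℝ × ℝ) → ℝ) : Prop :=
  ∃ U : Set (Fin n → ℝ × ℝ), IsOpen U ∧ ClosedPolydisk n ⊆ U ∧ AnalyticOnNhd ℝ ρ U

/-- The coordinates `uᵏ = e^{-2πyᵏ} cos(2πxᵏ)`, `vᵏ = e^{-2πyᵏ} sin(2πxᵏ)`. -/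
def uv (n : ℕ) (p : Pt n) : Fin n → ℝ × ℝ := fun k =>
  (Real.exp (-(2 * Real.pi * p.2 k)) * Real.cos (2 * Real.pi * p.1 k),
   Real.exp (-(2 * Real.pi * p.2 k)) * Real.sin (2 * Real.pi * p.1 k))

/-- Membership in the ring `O`: on `Σ_n`, `f` is given by a restricted analytic
function of the variables `uᵏ, vᵏ`. -/
def InO (n : ℕ) (f : Pt n → ℝ) : Prop :=
  ∃ ρ, RestrictedAnalytic n ρ ∧ ∀ p ∈ GrowthSector n, f p = ρ (uv n p)

/-- The monomial `(y¹)^{m₁} ⋯ (yⁿ)^{mₙ}`. -/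
def monomial (n : ℕ) (m : Fin n → ℤ) : Pt n → ℝ := fun p => ∏ k, p.2 k ^ m k

/-- Membership in `O[x,y,y⁻¹]`: a finite sum `∑ ρ_{k,m} x^k y^m` with `ρ_{k,m} ∈ O`,
`k ∈ ℕⁿ`, `m ∈ ℤⁿ`. -/
def InOPoly (n : ℕ) (f : Pt n → ℝ) : Prop :=
  ∃ (T : Finset ((Fin n → ℕ) × (Fin n → ℤ)))
    (ρ : ((Fin n → ℕ) × (Fin n → ℤ)) → Pt n → ℝ),
    (∀ km ∈ T, InO n (ρ km)) ∧
    ∀ p ∈ GrowthSector n,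
      f p = ∑ km ∈ T, ρ km p * (∏ k, p.1 k ^ km.1 k) * (∏ k, p.2 k ^ km.2 k)

/-- Membership in `O(x,y)`: a quotient `g/h` with `g, h ∈ O[x,y,y⁻¹]` and `h`
nowhere vanishing on `Σ_n`. -/
def InOFrac (n : ℕ) (f : Pt n → ℝ) : Prop :=
  ∃ g h, InOPoly n g ∧ InOPoly n h ∧ (∀ p ∈ GrowthSector n, h p ≠ 0) ∧
    ∀ p ∈ GrowthSector n, f p = g p / h p

/-- `f` has monomial growth: `f ∼ (y¹)^{m₁}⋯(yⁿ)^{mₙ}` on `Σ_n` for some `m ∈ ℤⁿ`. -/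
def MonGrowth (n : ℕ) (f : Pt n → ℝ) : Prop :=
  ∃ m : Fin n → ℤ, Sim (GrowthSector n) f (monomial n m)

/-- `f` is monomially tamed: `f ∈ O(x,y)` and `f ∼ (y¹)^{m₁}⋯(yⁿ)^{mₙ}` on `Σ_n`. -/
def MonTamed (n : ℕ) (f : Pt n → ℝ) : Prop := InOFrac n f ∧ MonGrowth n f

/-- `f` is polynomially tamed: `f = g/h` with `g ∈ O[x,y,y⁻¹]` and `h` monomially tamed. -/
def PolyTamed (n : ℕ) (f : Pt n → ℝ) : Prop :=
  ∃ g h, InOPoly n g ∧ MonTamed n h ∧ (∀ p ∈ GrowthSector n, h p ≠ 0) ∧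
    ∀ p ∈ GrowthSector n, f p = g p / h p

/-- The open box `{0 < xᵏ < 1, yᵏ > 1}`, to which all elements of `O(x,y)` extend
real-analytically, so that partial derivatives are well defined. -/
def OpenBox (n : ℕ) : Set (Pt n) :=
  {p | ∀ k, (0 < p.1 k ∧ p.1 k < 1) ∧ 1 < p.2 k}

/-- Membership in the ring `O`, witnessed on a set `S`. -/
def InOOn (n : ℕ) (S : Set (Pt n)) (f : Pt n → ℝ) : Prop :=
  ∃ ρ, RestrictedAnalytic n ρ ∧ ∀ p ∈ S, f p = ρ (uv n p)

/-- Membership in `O[x,y,y⁻¹]`, witnessed on a set `S`. -/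
def InOPolyOn (n : ℕ) (S : Set (Pt n)) (f : Pt n → ℝ) : Prop :=
  ∃ (T : Finset ((Fin n → ℕ) × (Fin n → ℤ)))
    (ρ : ((Fin n → ℕ) × (Fin n → ℤ)) → Pt n → ℝ),
    (∀ km ∈ T, InOOn n S (ρ km)) ∧
    ∀ p ∈ S,
      f p = ∑ km ∈ T, ρ km p * (∏ k, p.1 k ^ km.1 k) * (∏ k, p.2 k ^ km.2 k)

/-- The partial derivative of `f` with respect to `xᵏ`. -/
def partialX (n : ℕ) (k : Fin n) (f : Pt n → ℝ) : Pt n → ℝ := fun p =>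
  deriv (fun t => f (Function.update p.1 k t, p.2)) (p.1 k)

/-- The partial derivative of `f` with respect to `yᵏ`. -/
def partialY (n : ℕ) (k : Fin n) (f : Pt n → ℝ) : Pt n → ℝ := fun p =>
  deriv (fun t => f (p.1, Function.update p.2 k t)) (p.2 k)

/-- A single term. -/
def term (n : ℕ) (ρ : (Fin n → ℝ × ℝ) → ℝ) (a : Fin n → ℕ) (m : Fin n → ℤ) : Pt n → ℝ :=
  fun p => ρ (uv n p) * (∏ k, p.1 k ^ a k) * (∏ k, p.2 k ^ m k)

lemma uv_mem {n : ℕ} {p : Pt n} (hp : p ∈ OpenBox n) : uv n p ∈ ClosedPolydisk n := by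
  intro k
  have h1 : 1 < p.2 k := (hp k).2
  have h2 : Real.exp (-(2 * Real.pi * p.2 k)) ≤ 1 := by
    rw [Real.exp_le_one_iff]
    have := Real.pi_pos
    have : 0 < 2 * Real.pi * p.2 k := by positivity
    linarith
  have h3 := Real.exp_pos (-(2 * Real.pi * p.2 k))
  have h4 := Real.sin_sq_add_cos_sq (2 * Real.pi * p.1 k)
  simp only [uv]
  calc _ = Real.exp (-(2 * Real.pi * p.2 k)) ^ 2 *
        (Real.sin (2 * Real.pi * p.1 k) ^ 2 + Real.cos (2 * Real.pi * p.1 k) ^ 2) := by ring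
    _ ≤ 1 := by rw [h4, mul_one]; exact pow_le_one₀ h3.le h2

lemma isOpen_box (n : ℕ) : IsOpen (OpenBox n) := by
  have : OpenBox n = ⋂ k, {p : Pt n | (0 < p.1 k ∧ p.1 k < 1) ∧ 1 < p.2 k} := by
    ext p; simp [OpenBox]
  rw [this]
  refine isOpen_iInter_of_finite fun k => ?_
  refine IsOpen.and (IsOpen.and ?_ ?_) ?_
  · exact isOpen_lt (by fun_prop) (by fun_prop)
  · exact isOpen_lt (by fun_prop) (by fun_prop)
  · exact isOpen_lt (by fun_prop) (by fun_prop)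

lemma ra_const (n : ℕ) (c : ℝ) : RestrictedAnalytic n (fun _ => c) :=
  ⟨Set.univ, isOpen_univ, Set.subset_univ _, fun _ _ => analyticAt_const⟩

lemma ra_add {n : ℕ} {ρ σ} (h1 : RestrictedAnalytic n ρ) (h2 : RestrictedAnalytic n σ) :
    RestrictedAnalytic n (fun q => ρ q + σ q) := by
  obtain ⟨U, a, b, c⟩ := h1
  obtain ⟨V, a', b', c'⟩ := h2
  exact ⟨U ∩ V, a.inter a', Set.subset_inter b b', fun x hx => (c x hx.1).add (c' x hx.2)⟩

lemma ra_mul {n : ℕ} {ρ σ} (h1 : RestrictedAnalytic n ρ) (h2 : RestrictedAnalytic n σ) :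
    RestrictedAnalytic n (fun q => ρ q * σ q) := by
  obtain ⟨U, a, b, c⟩ := h1
  obtain ⟨V, a', b', c'⟩ := h2
  exact ⟨U ∩ V, a.inter a', Set.subset_inter b b', fun x hx => (c x hx.1).mul (c' x hx.2)⟩

lemma poly_congr {n : ℕ} {S : Set (Pt n)} {f g : Pt n → ℝ} (hf : InOPolyOn n S f)
    (h : ∀ p ∈ S, g p = f p) : InOPolyOn n S g := by
  obtain ⟨T, ρ, h1, h2⟩ := hf
  exact ⟨T, ρ, h1, fun p hp => (h p hp).trans (h2 p hp)⟩

lemma poly_mono {n : ℕ} {S S' : Set (Pt n)} {f : Pt n → ℝ} (hf : InOPolyOn n S f)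
    (h : S' ⊆ S) : InOPolyOn n S' f := by
  obtain ⟨T, ρ, h1, h2⟩ := hf
  refine ⟨T, ρ, fun km hk => ?_, fun p hp => h2 p (h hp)⟩
  obtain ⟨r, a, b⟩ := h1 km hk
  exact ⟨r, a, fun p hp => b p (h hp)⟩

lemma poly_zero (n : ℕ) (S : Set (Pt n)) : InOPolyOn n S (fun _ => 0) :=
  ⟨∅, fun _ _ => 0, by simp, by simp⟩

lemma poly_term {n : ℕ} (S : Set (Pt n)) {ρ} (hρ : RestrictedAnalytic n ρ) (a m) :
    InOPolyOn n S (term n ρ a m) :=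
  ⟨{(a, m)}, fun _ p => ρ (uv n p), fun _ _ => ⟨ρ, hρ, fun _ _ => rfl⟩,
    fun p _ => by simp [term]⟩

lemma poly_add {n : ℕ} {S : Set (Pt n)} {f g : Pt n → ℝ} (hf : InOPolyOn n S f)
    (hg : InOPolyOn n S g) : InOPolyOn n S (fun p => f p + g p) := by
  classical
  obtain ⟨T, ρ, h1, h2⟩ := hf
  obtain ⟨T', σ, h1', h2'⟩ := hg
  have key : ∀ (T : Finset ((Fin n → ℕ) × (Fin n → ℤ)))
      (ρ : ((Fin n → ℕ) × (Fin n → ℤ)) → Pt n → ℝ) (h1 : ∀ km ∈ T, InOOn n S (ρ km)) (km),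
      InOOn n S (fun p => if km ∈ T then ρ km p else 0) := by
    intro T ρ h1 km
    by_cases h : km ∈ T
    · simpa [h] using h1 km h
    · exact ⟨_, ra_const n 0, fun _ _ => by simp [h]⟩
  refine ⟨T ∪ T', fun km p => (if km ∈ T then ρ km p else 0) + (if km ∈ T' then σ km p else 0),
    fun km _ => ?_, fun p hp => ?_⟩
  · obtain ⟨r, a, b⟩ := key T ρ h1 km
    obtain ⟨r', a', b'⟩ := key T' σ h1' km
    exact ⟨_, ra_add a a', fun p hp => congrArg₂ (· + ·) (b p hp) (b' p hp)⟩
  · beta_reduce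
    rw [h2 p hp, h2' p hp]
    simp only [add_mul, Finset.sum_add_distrib, ite_mul, zero_mul]
    rw [← Finset.sum_filter, ← Finset.sum_filter]
    congr 2
    · ext; simp
    · ext; simp

lemma poly_sum {n : ℕ} {S : Set (Pt n)} {ι : Type*} (T : Finset ι) (F : ι → Pt n → ℝ)
    (h : ∀ i ∈ T, InOPolyOn n S (F i)) : InOPolyOn n S (fun p => ∑ i ∈ T, F i p) := by
  classical
  induction T using Finset.induction_on with
  | empty => simpa using poly_zero n S
  | insert i T hi ih =>
    simp only [Finset.sum_insert hi]
    exact poly_add (h i (by simp)) (ih fun j hj => h j (by simp [hj]))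

/-- Every element is a finite sum of terms. -/
lemma poly_exists {n : ℕ} {S : Set (Pt n)} {f : Pt n → ℝ} (hf : InOPolyOn n S f) :
    ∃ (T : Finset ((Fin n → ℕ) × (Fin n → ℤ))) (r : ((Fin n → ℕ) × (Fin n → ℤ)) →
      (Fin n → ℝ × ℝ) → ℝ), (∀ i, RestrictedAnalytic n (r i)) ∧
      ∀ p ∈ S, f p = ∑ i ∈ T, term n (r i) i.1 i.2 p := by
  classical
  obtain ⟨T, ρ, h1, h2⟩ := hf
  have : ∀ i, ∃ r, RestrictedAnalytic n r ∧ (i ∈ T → ∀ p ∈ S, ρ i p = r (uv n p)) := by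
    intro i
    by_cases h : i ∈ T
    · obtain ⟨r, a, b⟩ := h1 i h
      exact ⟨r, a, fun _ => b⟩
    · exact ⟨_, ra_const n 0, fun h' => absurd h' h⟩
  choose r ha hb using this
  refine ⟨T, r, ha, fun p hp => ?_⟩
  rw [h2 p hp]
  refine Finset.sum_congr rfl fun i hi => ?_
  rw [hb i hi p hp]; rfl

lemma poly_mul {n : ℕ} {f g : Pt n → ℝ} (hf : InOPolyOn n (OpenBox n) f)
    (hg : InOPolyOn n (OpenBox n) g) : InOPolyOn n (OpenBox n) (fun p => f p * g p) := by
  obtain ⟨T, r, h1, h2⟩ := poly_exists hf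
  obtain ⟨T', r', h1', h2'⟩ := poly_exists hg
  have := poly_sum (S := OpenBox n) T (fun i p => ∑ j ∈ T', term n (fun q => r i q * r' j q)
    (i.1 + j.1) (i.2 + j.2) p) (fun i _ => poly_sum T' _ fun j _ =>
      poly_term _ (ra_mul (h1 i) (h1' j)) _ _)
  refine poly_congr this fun p hp => ?_
  rw [h2 p hp, h2' p hp, Finset.sum_mul_sum]
  refine Finset.sum_congr rfl fun i _ => Finset.sum_congr rfl fun j _ => ?_
  have hy : ∀ k, p.2 k ≠ 0 := fun k => (zero_lt_one.trans (hp k).2).ne'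
  simp only [term, Pi.add_apply, pow_add, zpow_add₀ (hy _), Finset.prod_mul_distrib]
  ring

lemma poly_ra {n : ℕ} (S : Set (Pt n)) {ρ} (hρ : RestrictedAnalytic n ρ) :
    InOPolyOn n S (fun p => ρ (uv n p)) :=
  poly_congr (poly_term S hρ 0 0) (by intro p _; simp [term])

lemma poly_const (n : ℕ) (S : Set (Pt n)) (c : ℝ) : InOPolyOn n S (fun _ => c) :=
  poly_ra S (ra_const n c)

lemma poly_x {n : ℕ} (S : Set (Pt n)) (j : Fin n) (a : ℕ) :
    InOPolyOn n S (fun p => p.1 j ^ a) := by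
  classical
  refine poly_congr (poly_term S (ra_const n 1) (Pi.single j a) 0) ?_
  intro p _
  simp only [term, Pi.zero_apply, zpow_zero, Finset.prod_const_one, mul_one, one_mul]
  rw [Finset.prod_eq_single j]
  · simp
  · intro b _ hb; simp [hb]
  · simp

lemma poly_y {n : ℕ} (S : Set (Pt n)) (j : Fin n) (a : ℤ) :
    InOPolyOn n S (fun p => p.2 j ^ a) := by
  classical
  refine poly_congr (poly_term S (ra_const n 1) 0 (Pi.single j a)) ?_
  intro p _
  simp only [term, Pi.zero_apply, pow_zero, Finset.prod_const_one, one_mul]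
  rw [Finset.prod_eq_single j]
  · simp
  · intro b _ hb; simp [hb]
  · simp

/-- Differentiable in direction `e` with derivative again in the ring. -/
def HasD (n : ℕ) (e : Pt n) (f : Pt n → ℝ) : Prop :=
  InOPolyOn n (OpenBox n) f ∧ ∃ f', InOPolyOn n (OpenBox n) f' ∧
    ∀ p ∈ OpenBox n, ∃ F : Pt n →L[ℝ] ℝ, HasFDerivAt f F p ∧ F e = f' p

lemma hasD_congr {n : ℕ} {e : Pt n} {f g : Pt n → ℝ} (hf : HasD n e f)
    (h : ∀ p ∈ OpenBox n, g p = f p) : HasD n e g := by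
  obtain ⟨h1, f', h2, h3⟩ := hf
  refine ⟨poly_congr h1 h, f', h2, fun p hp => ?_⟩
  obtain ⟨F, hF, hF'⟩ := h3 p hp
  refine ⟨F, hF.congr_of_eventuallyEq ?_, hF'⟩
  filter_upwards [(isOpen_box n).mem_nhds hp] with q hq using h q hq

lemma hasD_add {n : ℕ} {e : Pt n} {f g : Pt n → ℝ} (hf : HasD n e f) (hg : HasD n e g) :
    HasD n e (fun p => f p + g p) := by
  obtain ⟨h1, f', h2, h3⟩ := hf
  obtain ⟨k1, g', k2, k3⟩ := hg
  refine ⟨poly_add h1 k1, _, poly_add h2 k2, fun p hp => ?_⟩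
  obtain ⟨F, hF, hF'⟩ := h3 p hp
  obtain ⟨G, hG, hG'⟩ := k3 p hp
  exact ⟨F + G, hF.add hG, by simp [hF', hG']⟩

lemma hasD_mul {n : ℕ} {e : Pt n} {f g : Pt n → ℝ} (hf : HasD n e f) (hg : HasD n e g) :
    HasD n e (fun p => f p * g p) := by
  obtain ⟨h1, f', h2, h3⟩ := hf
  obtain ⟨k1, g', k2, k3⟩ := hg
  refine ⟨poly_mul h1 k1, _, poly_add (poly_mul h1 k2) (poly_mul k1 h2), fun p hp => ?_⟩
  obtain ⟨F, hF, hF'⟩ := h3 p hp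
  obtain ⟨G, hG, hG'⟩ := k3 p hp
  exact ⟨_, hF.mul hG, by simp [hF', hG']⟩

lemma hasD_const (n : ℕ) (e : Pt n) (c : ℝ) : HasD n e (fun _ => c) :=
  ⟨poly_const n _ c, _, poly_zero n _, fun p _ => ⟨0, hasFDerivAt_const c p, by simp⟩⟩

lemma hasD_sum {n : ℕ} {e : Pt n} {ι : Type*} (T : Finset ι) (F : ι → Pt n → ℝ)
    (h : ∀ i ∈ T, HasD n e (F i)) : HasD n e (fun p => ∑ i ∈ T, F i p) := by
  classical
  induction T using Finset.induction_on with
  | empty => simpa using hasD_const n e 0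
  | insert i T hi ih =>
    simp only [Finset.sum_insert hi]
    exact hasD_add (h i (by simp)) (ih fun j hj => h j (by simp [hj]))

lemma hasD_prod {n : ℕ} {e : Pt n} {ι : Type*} (T : Finset ι) (F : ι → Pt n → ℝ)
    (h : ∀ i ∈ T, HasD n e (F i)) : HasD n e (fun p => ∏ i ∈ T, F i p) := by
  classical
  induction T using Finset.induction_on with
  | empty => simpa using hasD_const n e 1
  | insert i T hi ih =>
    simp only [Finset.prod_insert hi]
    exact hasD_mul (h i (by simp)) (ih fun j hj => h j (by simp [hj]))

lemma hasF_x {n : ℕ} (j : Fin n) (p : Pt n) : HasFDerivAt (fun p : Pt n => p.1 j)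
    ((ContinuousLinearMap.proj j).comp (ContinuousLinearMap.fst ℝ (Fin n → ℝ) (Fin n → ℝ))) p :=
  ((ContinuousLinearMap.proj (R := ℝ) (φ := fun _ : Fin n => ℝ) j).comp
    (ContinuousLinearMap.fst ℝ (Fin n → ℝ) (Fin n → ℝ))).hasFDerivAt

lemma hasF_y {n : ℕ} (j : Fin n) (p : Pt n) : HasFDerivAt (fun p : Pt n => p.2 j)
    ((ContinuousLinearMap.proj j).comp (ContinuousLinearMap.snd ℝ (Fin n → ℝ) (Fin n → ℝ))) p :=
  ((ContinuousLinearMap.proj (R := ℝ) (φ := fun _ : Fin n => ℝ) j).comp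
    (ContinuousLinearMap.snd ℝ (Fin n → ℝ) (Fin n → ℝ))).hasFDerivAt

lemma hasD_x {n : ℕ} (e : Pt n) (j : Fin n) (a : ℕ) : HasD n e (fun p => p.1 j ^ a) := by
  refine ⟨poly_x _ j a, _, poly_mul (poly_const n _ (a * e.1 j)) (poly_x _ j (a - 1)),
    fun p hp => ?_⟩
  refine ⟨_, (hasDerivAt_pow a (p.1 j)).comp_hasFDerivAt p (hasF_x j p), ?_⟩
  simp
  ring

lemma hasD_y {n : ℕ} (e : Pt n) (j : Fin n) (a : ℤ) : HasD n e (fun p => p.2 j ^ a) := by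
  refine ⟨poly_y _ j a, _, poly_mul (poly_const n _ (a * e.2 j)) (poly_y _ j (a - 1)),
    fun p hp => ?_⟩
  have hz := hasDerivAt_zpow a (p.2 j) (Or.inl (zero_lt_one.trans (hp j).2).ne')
  have hc := HasDerivAt.comp_hasFDerivAt (f := fun p : Pt n => p.2 j) p hz (hasF_y j p)
  refine ⟨_, hc, ?_⟩
  simp
  ring

/-- The linear vector field by which `e` acts in the `uv` coordinates. -/
def vf (n : ℕ) (e : Pt n) (q : Fin n → ℝ × ℝ) : Fin n → ℝ × ℝ := fun j =>
  (2 * Real.pi * (-(e.2 j * (q j).1) - e.1 j * (q j).2),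
   2 * Real.pi * (-(e.2 j * (q j).2) + e.1 j * (q j).1))

lemma uv_deriv {n : ℕ} (e p : Pt n) :
    ∃ F : Pt n →L[ℝ] (Fin n → ℝ × ℝ), HasFDerivAt (uv n) F p ∧ F e = vf n e (uv n p) := by
  have key : ∀ j, ∃ F : Pt n →L[ℝ] ℝ × ℝ, HasFDerivAt (fun p => uv n p j) F p ∧
      F e = vf n e (uv n p) j := by
    intro j
    have hx := (hasF_x j p).const_mul (2 * Real.pi)
    have hy := ((hasF_y j p).const_mul (2 * Real.pi)).fun_neg.exp
    refine ⟨_, (hy.mul hx.cos).prodMk (hy.mul hx.sin), ?_⟩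
    simp [vf, uv]
    constructor <;> ring
  choose F h1 h2 using key
  refine ⟨ContinuousLinearMap.pi F, hasFDerivAt_pi.2 h1, ?_⟩
  ext j <;> simp [h2]

lemma hasD_ra {n : ℕ} (e : Pt n) {ρ} (hρ : RestrictedAnalytic n ρ) :
    HasD n e (fun p => ρ (uv n p)) := by
  have hρ' := hρ
  obtain ⟨U, hU, hsub, ha⟩ := hρ
  have hvf : ∀ q, AnalyticAt ℝ (vf n e) q := by
    intro q
    have hlin : ∃ A : (Fin n → ℝ × ℝ) →ₗ[ℝ] (Fin n → ℝ × ℝ), ∀ q, A q = vf n e q := by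
      refine ⟨⟨⟨vf n e, ?_⟩, ?_⟩, fun _ => rfl⟩
      · intro x y; ext j <;> simp [vf] <;> ring
      · intro c x; ext j <;> simp [vf] <;> ring
    obtain ⟨A, hA⟩ := hlin
    have : vf n e = LinearMap.toContinuousLinearMap A := by
      ext1 q; simp [hA]
    rw [this]
    exact ContinuousLinearMap.analyticAt _ _
  have hd : RestrictedAnalytic n (fun q => fderiv ℝ ρ q (vf n e q)) :=
    ⟨U, hU, hsub, fun q hq => 
      ((ContinuousLinearMap.id ℝ ((Fin n → ℝ × ℝ) →L[ℝ] ℝ)).analyticAt_bilinear _).comp₂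
        (ha.fderiv q hq) (hvf q)⟩
  refine ⟨poly_ra _ hρ', _, poly_ra _ hd, fun p hp => ?_⟩
  obtain ⟨F, hF, hFe⟩ := uv_deriv e p
  have h1 := (ha _ (hsub (uv_mem hp))).differentiableAt.hasFDerivAt
  exact ⟨_, h1.comp p hF, by simp [hFe]⟩

lemma hasD_poly {n : ℕ} (e : Pt n) {f} (hf : InOPolyOn n (OpenBox n) f) : HasD n e f := by
  obtain ⟨T, r, h1, h2⟩ := poly_exists hf
  refine hasD_congr (hasD_sum T (fun i => term n (r i) i.1 i.2) fun i _ => ?_) h2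
  exact hasD_mul (hasD_mul (hasD_ra e (h1 i)) (hasD_prod _ _ fun j _ => hasD_x e j _))
    (hasD_prod _ _ fun j _ => hasD_y e j _)

lemma sector_sub (n : ℕ) : GrowthSector n ⊆ OpenBox n := fun _ hp k => ⟨hp.1 k, hp.2.2 k⟩

lemma growth_sq {n : ℕ} {h : Pt n → ℝ} (hh : MonGrowth n h) :
    MonGrowth n (fun p => h p * h p) := by
  obtain ⟨m, C₁, C₂, hC, hb⟩ := hh
  have hm : ∀ p ∈ GrowthSector n, 0 < monomial n m p ∧
      monomial n (m + m) p = monomial n m p * monomial n m p := by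
    intro p hp
    have hy : ∀ k, 0 < p.2 k := fun k => zero_lt_one.trans (hp.2.2 k)
    refine ⟨Finset.prod_pos fun k _ => zpow_pos (hy k) _, ?_⟩
    simp only [monomial, Pi.add_apply, zpow_add₀ (hy _).ne', Finset.prod_mul_distrib]
  rcases pos_and_pos_or_neg_and_neg_of_mul_pos hC with ⟨c1, c2⟩ | ⟨c1, c2⟩
  · refine ⟨m + m, C₁ * C₁, C₂ * C₂, by positivity, fun p hp => ?_⟩
    obtain ⟨hpos, he⟩ := hm p hp
    obtain ⟨a, b⟩ := hb p hp
    have := mul_pos c1 hpos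
    rw [he]
    constructor <;> nlinarith
  · refine ⟨m + m, C₂ * C₂, C₁ * C₁, mul_pos (mul_pos_of_neg_of_neg c2 c2)
      (mul_pos_of_neg_of_neg c1 c1), fun p hp => ?_⟩
    obtain ⟨hpos, he⟩ := hm p hp
    obtain ⟨a, b⟩ := hb p hp
    have := mul_neg_of_neg_of_pos c2 hpos
    rw [he]
    constructor <;> nlinarith

lemma main {n : ℕ} {f g h : Pt n → ℝ} (e : Pt n)
    (hg : InOPolyOn n (OpenBox n) g) (hh : InOPolyOn n (OpenBox n) h)
    (hhmon : MonGrowth n h)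
    (hh0 : ∀ p ∈ OpenBox n, h p ≠ 0)
    (hfgh : ∀ p ∈ OpenBox n, f p = g p / h p) (D : Pt n → ℝ)
    (hD : ∀ p ∈ OpenBox n, ∃ (L : ℝ → Pt n) (c : ℝ), L c = p ∧ HasDerivAt L e c ∧
      D p = deriv (fun t => f (L t)) c) : PolyTamed n D := by
  obtain ⟨-, g', hg', kg⟩ := hasD_poly e hg
  obtain ⟨-, h', hh', kh⟩ := hasD_poly e hh
  have hsub := sector_sub n
  refine ⟨fun p => g' p * h p + (-1) * (g p * h' p), fun p => h p * h p,
    poly_mono (poly_add (poly_mul hg' hh) (poly_mul (poly_const n _ (-1)) (poly_mul hg hh'))) hsub,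
    ⟨⟨fun p => h p * h p, fun _ => 1, poly_mono (poly_mul hh hh) hsub, poly_const n _ 1,
      by simp, by simp⟩, growth_sq hhmon⟩, fun p hp => mul_self_ne_zero.2 (hh0 p (hsub hp)),
      fun p hp => ?_⟩
  have hp' := hsub hp
  obtain ⟨L, c, rfl, hL, hDp⟩ := hD p hp'
  obtain ⟨G, hG, hGe⟩ := kg _ hp'
  obtain ⟨H, hH, hHe⟩ := kh _ hp'
  rw [hDp]
  have h1 := hG.comp_hasDerivAt c hL
  have h2 := hH.comp_hasDerivAt c hL
  have h3 := h1.div h2 (hh0 _ hp')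
  have h4 : (fun t => f (L t)) =ᶠ[nhds c] ((g ∘ L) / (h ∘ L)) := by
    filter_upwards [hL.continuousAt ((isOpen_box n).mem_nhds hp')] with t ht using hfgh _ ht
  rw [h4.deriv_eq, h3.deriv, hGe, hHe]
  simp only [Function.comp]
  congr 1 <;> ring

/-- Let `f` be a monomially tamed function on `Σ_n` admitting a
representation `f = g/h` with `g, h ∈ O[x,y,y⁻¹]` both monomially tamed (the
representation extending to the open box where derivatives are defined). Then every
first-order partial derivative of `f`, with respect to any `xᵏ` or `yᵏ`, is a
polynomially tamed function on `Σ_n`. -/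
theorem statement11 (n : ℕ) (hn : 1 ≤ n) (f g h : Pt n → ℝ)
    (hg : InOPolyOn n (OpenBox n) g) (hh : InOPolyOn n (OpenBox n) h)
    (hgmon : MonGrowth n g) (hhmon : MonGrowth n h)
    (hh0 : ∀ p ∈ OpenBox n, h p ≠ 0)
    (hfgh : ∀ p ∈ OpenBox n, f p = g p / h p)
    (hfmon : MonGrowth n f) :
    ∀ k : Fin n, PolyTamed n (partialX n k f) ∧ PolyTamed n (partialY n k f) := by
  intro k
  constructor
  · refine main (Pi.single k 1, 0) hg hh hhmon hh0 hfgh _ fun p _ =>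
      ⟨fun t => (Function.update p.1 k t, p.2), p.1 k, by simp, ?_, rfl⟩
    exact (hasDerivAt_update p.1 k (p.1 k)).prodMk (hasDerivAt_const _ _)
  · refine main (0, Pi.single k 1) hg hh hhmon hh0 hfgh _ fun p _ =>
      ⟨fun t => (p.1, Function.update p.2 k t), p.2 k, by simp, ?_, rfl⟩
    exact (hasDerivAt_const _ _).prodMk (hasDerivAt_update p.2 k (p.2 k))

end

end TamePaper
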